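/- Let D, Y, X be finite nonempty types and Z := D × (D → Y) × X, and let ≿ be a binary relation on lotteries on Z. The following are equivalent: (1) ≿ satisfies Completeness, Transitivity, Independence, Continuity, and Irrelevance of Counterfactual Correlation; (2) there exist functions u_k : D × Y × X → ℝ for k ∈ D such that the additive counterfactual utility ũ(d, y, x) := ∑ k ∈ D, u_k(d, y k, x) represents ≿. Moreover, any two such representing utilities ũ, ũ' are related by a positive affine transformation: there exist a > 0 and b ∈ ℝ with ũ' = a·ũ + b. -/

import Mathlib

/-- `p` is a lottery on the finite type `Z`. -/
def IsLottery {Z : Type*} [Fintype Z] (p : Z → ℝ) : Prop :=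
  (∀ z, 0 ≤ p z) ∧ ∑ z, p z = 1

/-- Expected utility of lottery `p` under utility `u`. -/
noncomputable def expUtil {Z : Type*} [Fintype Z] (u p : Z → ℝ) : ℝ :=
  ∑ z, u z * p z

/-- Mixture `α p + (1 - α) q`. -/
def mix {Z : Type*} (α : ℝ) (p q : Z → ℝ) : Z → ℝ :=
  fun z => α * p z + (1 - α) * q z

/-- `u` represents the relation `R` on lotteries. -/
def Represents {Z : Type*} [Fintype Z]
    (R : (Z → ℝ) → (Z → ℝ) → Prop) (u : Z → ℝ) : Prop :=
  ∀ p q : Z → ℝ, IsLottery p → IsLottery q → (R p q ↔ expUtil u p ≥ expUtil u q)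

/-- Strict preference `p ≻ q`. -/
def StrictPref {Z : Type*} (R : (Z → ℝ) → (Z → ℝ) → Prop) (p q : Z → ℝ) : Prop :=
  R p q ∧ ¬ R q p

/-- Completeness on lotteries. -/
def CompleteAx {Z : Type*} [Fintype Z] (R : (Z → ℝ) → (Z → ℝ) → Prop) : Prop :=
  ∀ p q : Z → ℝ, IsLottery p → IsLottery q → (R p q ∨ R q p)

/-- Transitivity on lotteries. -/
def TransitiveAx {Z : Type*} [Fintype Z] (R : (Z → ℝ) → (Z → ℝ) → Prop) : Prop :=
  ∀ p q r : Z → ℝ, IsLottery p → IsLottery q → IsLottery r → R p q → R q r → R p r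

/-- vNM Independence on lotteries. -/
def IndependenceAx {Z : Type*} [Fintype Z] (R : (Z → ℝ) → (Z → ℝ) → Prop) : Prop :=
  ∀ p q r : Z → ℝ, IsLottery p → IsLottery q → IsLottery r →
    ∀ α : ℝ, 0 < α → α ≤ 1 →
      StrictPref R p q → StrictPref R (mix α p r) (mix α q r)

/-- vNM Continuity on lotteries. -/
def ContinuityAx {Z : Type*} [Fintype Z] (R : (Z → ℝ) → (Z → ℝ) → Prop) : Prop :=
  ∀ p q r : Z → ℝ, IsLottery p → IsLottery q → IsLottery r →
    StrictPref R p q → StrictPref R q r →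
      ∃ α β : ℝ, 0 < α ∧ α < 1 ∧ 0 < β ∧ β < 1 ∧
        StrictPref R (mix α p r) q ∧ StrictPref R q (mix β p r)

section PotentialOutcomeSpace

variable {D Y X : Type*} [Fintype D] [DecidableEq D] [Fintype Y] [DecidableEq Y]
  [Fintype X] [DecidableEq X]

/-- Probability that the decision equals `d` under lottery `p` on `D × (D → Y) × X`. -/
noncomputable def probDec (p : D × (D → Y) × X → ℝ) (d : D) : ℝ :=
  ∑ z, if z.1 = d then p z else 0

/-- Probability that the covariate equals `x` under lottery `p`. -/
noncomputable def probCov (p : D × (D → Y) × X → ℝ) (x : X) : ℝ :=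
  ∑ z, if z.2.2 = x then p z else 0

/-- Probability that the potential outcome coordinate `y k` equals `v` under `p`. -/
noncomputable def probOut (p : D × (D → Y) × X → ℝ) (k : D) (v : Y) : ℝ :=
  ∑ z, if z.2.1 k = v then p z else 0

end PotentialOutcomeSpace

section Stmt2

variable {D Y X : Type*} [Fintype D] [DecidableEq D] [Fintype Y] [DecidableEq Y]
  [Fintype X] [DecidableEq X]

/-- Irrelevance of Counterfactual Correlation. -/
def IrrelevanceCounterfactualCorrelation
    (R : (D × (D → Y) × X → ℝ) → (D × (D → Y) × X → ℝ) → Prop) : Prop :=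
  ∀ p q : D × (D → Y) × X → ℝ, IsLottery p → IsLottery q →
    ∀ (d : D) (x : X),
      probDec p d = 1 → probDec q d = 1 →
      probCov p x = 1 → probCov q x = 1 →
      (∀ (k : D) (v : Y), probOut p k v = probOut q k v) →
      (R p q ∧ R q p)

end Stmt2

section Lottery

variable {Z : Type*} [Fintype Z]

lemma IsLottery.mix {p q : Z → ℝ} (hp : IsLottery p) (hq : IsLottery q) {α : ℝ}
    (h0 : 0 ≤ α) (h1 : α ≤ 1) : IsLottery (mix α p q) := by
  refine ⟨fun z => ?_, ?_⟩
  · have h := mul_nonneg h0 (hp.1 z)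
    have h' := mul_nonneg (sub_nonneg.2 h1) (hq.1 z)
    simp only [_root_.mix]
    linarith
  · simp only [_root_.mix, Finset.sum_add_distrib, ← Finset.mul_sum, hp.2, hq.2]
    ring

lemma isLottery_single [DecidableEq Z] (z : Z) : IsLottery (Pi.single z (1 : ℝ)) := by
  refine ⟨fun w => ?_, by simp⟩
  by_cases h : w = z
  · subst h; simp
  · simp [h]

lemma expUtil_mix (u p q : Z → ℝ) (α : ℝ) :
    expUtil u (mix α p q) = α * expUtil u p + (1 - α) * expUtil u q := by
  simp only [expUtil, mix, Finset.mul_sum, ← Finset.sum_add_distrib]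
  exact Finset.sum_congr rfl fun z _ => by ring

lemma expUtil_single [DecidableEq Z] (u : Z → ℝ) (z : Z) :
    expUtil u (Pi.single z 1) = u z := by
  simp [expUtil, Pi.single_apply]

/-- A set of lotteries closed under mixtures and containing all the degenerate lotteries
contains every lottery. -/
lemma forall_isLottery_of_single_of_mix [DecidableEq Z] {P : (Z → ℝ) → Prop}
    (single : ∀ z, P (Pi.single z 1))
    (mix : ∀ p q α, IsLottery p → IsLottery q → 0 ≤ α → α ≤ 1 → P p → P q → P (_root_.mix α p q)) :
    ∀ p, IsLottery p → P p := by
  intro p hp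
  have hconv : Convex ℝ {p : Z → ℝ | IsLottery p ∧ P p} := by
    intro p hp q hq a b ha hb hab
    have hb' : b = 1 - a := by linarith
    have h : a • p + b • q = _root_.mix a p q := by
      ext z; simp [_root_.mix, hb']
    rw [h]
    exact ⟨hp.1.mix hq.1 ha (by linarith),
      mix p q a hp.1 hq.1 ha (by linarith) hp.2 hq.2⟩
  have hsub : Set.range (fun z : Z => (Pi.single z 1 : Z → ℝ)) ⊆ {p | IsLottery p ∧ P p} := by
    rintro _ ⟨z, rfl⟩
    exact ⟨isLottery_single z, single z⟩
  have hmem : p ∈ stdSimplex ℝ Z := hp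
  rw [← convexHull_rangle_single_eq_stdSimplex] at hmem
  exact (convexHull_min hsub hconv hmem).2

end Lottery

lemma mix_self {Z : Type*} (α : ℝ) (p : Z → ℝ) : mix α p p = p := by
  ext z; simp only [mix]; ring

lemma mix_comm {Z : Type*} (α : ℝ) (p q : Z → ℝ) : mix α p q = mix (1 - α) q p := by
  ext z; simp only [mix]; ring

lemma mix_zero {Z : Type*} (p q : Z → ℝ) : mix 0 p q = q := by
  ext z; simp [mix]

lemma mix_one {Z : Type*} (p q : Z → ℝ) : mix 1 p q = p := by
  ext z; simp [mix]

/-- The von Neumann–Morgenstern axioms. -/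
structure IsVNM {Z : Type*} [Fintype Z] (R : (Z → ℝ) → (Z → ℝ) → Prop) : Prop where
  complete : CompleteAx R
  transitive : TransitiveAx R
  independent : IndependenceAx R
  continuous : ContinuityAx R

namespace IsVNM

variable {Z : Type*} [Fintype Z] {R : (Z → ℝ) → (Z → ℝ) → Prop} (h : IsVNM R)
  {p q r : Z → ℝ}

include h

lemma refl (hp : IsLottery p) : R p p := (h.complete p p hp hp).elim id id

lemma strict_of_not (hp : IsLottery p) (hq : IsLottery q) (hn : ¬ R q p) : StrictPref R p q :=
  ⟨(h.complete p q hp hq).resolve_right hn, hn⟩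

lemma strict_of_strict_of_pref (hp : IsLottery p) (hq : IsLottery q) (hr : IsLottery r)
    (h1 : StrictPref R p q) (h2 : R q r) : StrictPref R p r :=
  ⟨h.transitive p q r hp hq hr h1.1 h2, fun h3 => h1.2 (h.transitive q r p hq hr hp h2 h3)⟩

lemma strict_of_pref_of_strict (hp : IsLottery p) (hq : IsLottery q) (hr : IsLottery r)
    (h1 : R p q) (h2 : StrictPref R q r) : StrictPref R p r :=
  ⟨h.transitive p q r hp hq hr h1 h2.1, fun h3 => h2.2 (h.transitive r p q hr hp hq h3 h1)⟩

lemma mix_strict_right (hp : IsLottery p) (hq : IsLottery q) (hpq : StrictPref R p q)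
    {α : ℝ} (h0 : 0 < α) (h1 : α ≤ 1) : StrictPref R (mix α p q) q := by
  simpa only [mix_self] using h.independent p q q hp hq hq α h0 h1 hpq

lemma strict_mix_left (hp : IsLottery p) (hq : IsLottery q) (hpq : StrictPref R p q)
    {α : ℝ} (h0 : 0 ≤ α) (h1 : α < 1) : StrictPref R p (mix α p q) := by
  have := h.independent p q p hp hq hp (1 - α) (by linarith) (by linarith) hpq
  rwa [mix_self, ← mix_comm] at this

lemma mix_strict_mix (hp : IsLottery p) (hq : IsLottery q) (hpq : StrictPref R p q)
    {α β : ℝ} (h0 : 0 ≤ β) (hlt : β < α) (h1 : α ≤ 1) :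
    StrictPref R (mix α p q) (mix β p q) := by
  have hα : 0 < α := by linarith
  have := h.strict_mix_left (hp.mix hq hα.le h1) hq (h.mix_strict_right hp hq hpq hα h1)
    (div_nonneg h0 hα.le) ((div_lt_one hα).2 hlt)
  convert this using 1
  ext z
  simp only [mix]
  field_simp
  ring

/-- Weak independence: mixing two indifferent lotteries with a third one preserves `≿`. -/
lemma mix_pref_of_indiff (hp : IsLottery p) (hq : IsLottery q) (hr : IsLottery r)
    (hpq : R p q) (hqp : R q p) {α : ℝ} (h0 : 0 ≤ α) (h1 : α ≤ 1) :
    R (mix α q r) (mix α p r) := by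
  rcases h0.eq_or_lt with rfl | h0'
  · simpa only [mix_zero] using h.refl hr
  have hx := hp.mix hr h0 h1
  have hy := hq.mix hr h0 h1
  by_contra hn
  have hxy := h.strict_of_not hx hy hn
  by_cases hs : ∃ s, IsLottery s ∧ StrictPref R s p
  · obtain ⟨s, hs, hsp⟩ := hs
    obtain ⟨_, β, -, -, hβ0, hβ1, -, hβ⟩ := h.continuous _ _ _ (hs.mix hr h0 h1) hx hy
      (h.independent s p r hs hp hr α h0' h1 hsp) hxy
    have hsq := h.strict_of_strict_of_pref hs hp hq hsp hpq
    have hm := hs.mix hq hβ0.le hβ1.le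
    have h2 := h.independent _ p r hm hp hr α h0' h1
      (h.strict_of_strict_of_pref hm hq hp (h.mix_strict_right hs hq hsq hβ0 hβ1.le) hqp)
    have e : mix α (mix β s q) r = mix β (mix α s r) (mix α q r) := by
      ext z; simp only [mix]; ring
    rw [e] at h2
    exact hβ.2 h2.1
  by_cases hs' : ∃ s, IsLottery s ∧ StrictPref R q s
  · obtain ⟨s, hs, hqs⟩ := hs'
    obtain ⟨β, _, hβ0, hβ1, -, -, hβ, -⟩ := h.continuous _ _ _ hx hy (hs.mix hr h0 h1) hxy
      (h.independent q s r hq hs hr α h0' h1 hqs)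
    have hps := h.strict_of_pref_of_strict hp hq hs hpq hqs
    have hm := hp.mix hs hβ0.le hβ1.le
    have h2 := h.independent q _ r hq hm hr α h0' h1
      (h.strict_of_pref_of_strict hq hp hm hqp (h.strict_mix_left hp hs hps hβ0.le hβ1))
    have e : mix α (mix β p s) r = mix β (mix α p r) (mix α s r) := by
      ext z; simp only [mix]; ring
    rw [e] at h2
    exact hβ.2 h2.1
  push Not at hs hs'
  have h2 : R p (mix α p r) := by
    by_contra hc
    exact hs _ hx (h.strict_of_not hx hp hc)
  have h3 : R (mix α q r) q := by
    by_contra hc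
    exact hs' _ hy (h.strict_of_not hq hy hc)
  exact hn (h.transitive _ _ _ hy hq hx h3 (h.transitive _ _ _ hq hp hx hqp h2))

lemma exists_indiff_mix {b w : Z → ℝ} (hb : IsLottery b) (hw : IsLottery w) (hr : IsLottery r)
    (hbr : R b r) (hrw : R r w) :
    ∃ t : ℝ, 0 ≤ t ∧ t ≤ 1 ∧ R r (mix t b w) ∧ R (mix t b w) r := by
  by_cases hrb : R r b
  · exact ⟨1, by simp, le_rfl, by rwa [mix_one], by rwa [mix_one]⟩
  by_cases hwr : R w r
  · exact ⟨0, le_rfl, by simp, by rwa [mix_zero], by rwa [mix_zero]⟩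
  have hsbr : StrictPref R b r := ⟨hbr, hrb⟩
  have hsrw : StrictPref R r w := ⟨hrw, hwr⟩
  have hsbw := h.strict_of_strict_of_pref hb hr hw hsbr hrw
  set S : Set ℝ := {t | 0 ≤ t ∧ t ≤ 1 ∧ R r (mix t b w)} with hS
  have hS0 : (0 : ℝ) ∈ S := ⟨le_rfl, zero_le_one, by rwa [mix_zero]⟩
  have hSb : BddAbove S := ⟨1, fun t ht => ht.2.1⟩
  have ht0 : 0 ≤ sSup S := le_csSup hSb hS0
  have ht1 : sSup S ≤ 1 := csSup_le ⟨0, hS0⟩ fun t ht => ht.2.1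
  have hm := hb.mix hw ht0 ht1
  refine ⟨sSup S, ht0, ht1, ?_, ?_⟩
  · by_contra hc
    have hmr := h.strict_of_not hm hr hc
    obtain ⟨α, _, hα0, hα1, -, -, hα, -⟩ := h.continuous _ _ _ hm hr hw hmr hsrw
    have e : mix α (mix (sSup S) b w) w = mix (α * sSup S) b w := by
      ext z; simp only [mix]; ring
    rw [e] at hα
    have hpos : 0 < sSup S := by
      refine ht0.lt_of_ne fun h0 => hc ?_
      rwa [← h0, mix_zero]
    obtain ⟨t, ht, hlt⟩ := exists_lt_of_lt_csSup ⟨0, hS0⟩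
      (show α * sSup S < sSup S by nlinarith)
    have hα' : 0 ≤ α * sSup S := by positivity
    have h2 := h.mix_strict_mix hb hw hsbw hα' hlt ht.2.1
    exact hα.2 (h.transitive _ _ _ hr (hb.mix hw ht.1 ht.2.1)
      (hb.mix hw hα' (hlt.le.trans ht.2.1)) ht.2.2 h2.1)
  · by_contra hc
    have hmr := h.strict_of_not hr hm hc
    obtain ⟨_, β, -, -, hβ0, hβ1, -, hβ⟩ := h.continuous _ _ _ hb hr hm hsbr hmr
    have e : mix β b (mix (sSup S) b w) = mix (β + (1 - β) * sSup S) b w := by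
      ext z; simp only [mix]; ring
    rw [e] at hβ
    have hlt : sSup S < 1 := by
      refine ht1.lt_of_ne fun h0 => hc ?_
      rwa [h0, mix_one]
    have hle : β + (1 - β) * sSup S ≤ sSup S :=
      le_csSup hSb ⟨by nlinarith, by nlinarith, hβ.1⟩
    nlinarith

lemma mix_indiff_mix {p' q' : Z → ℝ} (hp : IsLottery p) (hq : IsLottery q)
    (hp' : IsLottery p') (hq' : IsLottery q') (h1 : R p p' ∧ R p' p) (h2 : R q q' ∧ R q' q)
    {α : ℝ} (h0 : 0 ≤ α) (hα : α ≤ 1) :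
    R (mix α p q) (mix α p' q') := by
  have e1 := h.mix_pref_of_indiff hp' hp hq h1.2 h1.1 h0 hα
  have e2 := h.mix_pref_of_indiff hq' hq hp' h2.2 h2.1 (sub_nonneg.2 hα)
    (sub_le_self 1 h0)
  rw [← mix_comm, ← mix_comm] at e2
  exact h.transitive _ _ _ (hp.mix hq h0 hα) (hp'.mix hq h0 hα) (hp'.mix hq' h0 hα) e1 e2

/-- Existence of an extremal point for a family of lotteries indexed by a finite type. -/
lemma exists_best [Nonempty Z] (f : Z → Z → ℝ) (hf : ∀ z, IsLottery (f z)) :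
    ∃ b, ∀ z, R (f b) (f z) := by
  obtain ⟨b, -, hb⟩ := Finset.exists_max_image (Finset.univ : Finset Z)
    (fun z => Set.ncard {w | R (f z) (f w)}) Finset.univ_nonempty
  refine ⟨b, fun z => ?_⟩
  by_contra hn
  have hs := h.strict_of_not (hf z) (hf b) hn
  refine (hb z (Finset.mem_univ z)).not_gt (Set.ncard_lt_ncard ⟨fun w hw => ?_, fun hc => ?_⟩)
  · exact h.transitive _ _ _ (hf z) (hf b) (hf w) hs.1 hw
  · exact hn (hc (h.refl (hf z)))

lemma exists_worst [Nonempty Z] (f : Z → Z → ℝ) (hf : ∀ z, IsLottery (f z)) :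
    ∃ w, ∀ z, R (f z) (f w) := by
  obtain ⟨b, -, hb⟩ := Finset.exists_min_image (Finset.univ : Finset Z)
    (fun z => Set.ncard {w | R (f z) (f w)}) Finset.univ_nonempty
  refine ⟨b, fun z => ?_⟩
  by_contra hn
  have hs := h.strict_of_not (hf b) (hf z) hn
  refine (hb z (Finset.mem_univ z)).not_gt (Set.ncard_lt_ncard ⟨fun w hw => ?_, fun hc => ?_⟩)
  · exact h.transitive _ _ _ (hf b) (hf z) (hf w) hs.1 hw
  · exact hn (hc (h.refl (hf b)))

/-- The von Neumann–Morgenstern theorem on a finite type. -/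
theorem exists_represents [DecidableEq Z] [Nonempty Z] : ∃ u : Z → ℝ, Represents R u := by
  have hδ : ∀ z : Z, IsLottery (Pi.single z (1 : ℝ)) := isLottery_single
  obtain ⟨b, hb⟩ := h.exists_best _ hδ
  obtain ⟨w, hw⟩ := h.exists_worst _ hδ
  choose u hu0 hu1 hu hu' using fun z =>
    h.exists_indiff_mix (hδ b) (hδ w) (hδ z) (hb z) (hw z)
  have key : ∀ p, IsLottery p → (0 ≤ expUtil u p ∧ expUtil u p ≤ 1) ∧
      R p (mix (expUtil u p) (Pi.single b 1) (Pi.single w 1)) ∧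
      R (mix (expUtil u p) (Pi.single b 1) (Pi.single w 1)) p := by
    refine forall_isLottery_of_single_of_mix (fun z => ?_) fun p q α hp hq h0 h1 ihp ihq => ?_
    · rw [expUtil_single]; exact ⟨⟨hu0 z, hu1 z⟩, hu z, hu' z⟩
    · have e : mix (expUtil u (mix α p q)) (Pi.single b 1) (Pi.single w 1) =
          mix α (mix (expUtil u p) (Pi.single b 1) (Pi.single w 1))
            (mix (expUtil u q) (Pi.single b 1) (Pi.single w 1)) := by
        rw [expUtil_mix]; ext z; simp only [mix]; ring
      have hmp := (hδ b).mix (hδ w) ihp.1.1 ihp.1.2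
      have hmq := (hδ b).mix (hδ w) ihq.1.1 ihq.1.2
      rw [e, expUtil_mix]
      refine ⟨⟨?_, ?_⟩, h.mix_indiff_mix hp hq hmp hmq ihp.2 ihq.2 h0 h1,
        h.mix_indiff_mix hmp hmq hp hq ihp.2.symm ihq.2.symm h0 h1⟩
      · nlinarith [mul_nonneg h0 ihp.1.1, mul_nonneg (sub_nonneg.2 h1) ihq.1.1]
      · nlinarith [mul_le_mul_of_nonneg_left ihp.1.2 h0,
          mul_le_mul_of_nonneg_left ihq.1.2 (sub_nonneg.2 h1)]
  have hmix : ∀ p, IsLottery p →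
      IsLottery (mix (expUtil u p) (Pi.single b 1) (Pi.single w 1)) :=
    fun p hp => (hδ b).mix (hδ w) (key p hp).1.1 (key p hp).1.2
  have hiff : ∀ p q, IsLottery p → IsLottery q →
      (R p q ↔ R (mix (expUtil u p) (Pi.single b 1) (Pi.single w 1))
        (mix (expUtil u q) (Pi.single b 1) (Pi.single w 1))) := by
    intro p q hp hq
    constructor
    · intro hr
      exact h.transitive _ _ _ (hmix p hp) hp (hmix q hq) (key p hp).2.2
        (h.transitive _ _ _ hp hq (hmix q hq) hr (key q hq).2.1)
    · intro hr
      exact h.transitive _ _ _ hp (hmix p hp) hq (key p hp).2.1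
        (h.transitive _ _ _ (hmix p hp) (hmix q hq) hq hr (key q hq).2.2)
  by_cases hbw : R (Pi.single w 1) (Pi.single b 1)
  · refine ⟨fun _ => 0, fun p q hp hq => ?_⟩
    have hw' : ∀ p, IsLottery p → R p (Pi.single w 1) ∧ R (Pi.single w 1) p := by
      refine forall_isLottery_of_single_of_mix (fun z => ?_) fun p q α hp hq h0 h1 ihp ihq => ?_
      · exact ⟨hw z, h.transitive _ _ _ (hδ w) (hδ b) (hδ z) hbw (hb z)⟩
      · have e1 := h.mix_indiff_mix hp hq (hδ w) (hδ w) ihp ihq h0 h1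
        have e2 := h.mix_indiff_mix (hδ w) (hδ w) hp hq ihp.symm ihq.symm h0 h1
        rw [mix_self] at e1 e2
        exact ⟨e1, e2⟩
    simpa [expUtil] using h.transitive _ _ _ hp (hδ w) hq (hw' p hp).1 (hw' q hq).2
  · have hs : StrictPref R (Pi.single b (1 : ℝ)) (Pi.single w 1) := ⟨hb w, hbw⟩
    refine ⟨u, fun p q hp hq => (hiff p q hp hq).trans ?_⟩
    constructor
    · intro hr
      by_contra hlt
      exact (h.mix_strict_mix (hδ b) (hδ w) hs (key p hp).1.1 (not_le.1 hlt)
        (key q hq).1.2).2 hr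
    · intro hge
      rcases (ge_iff_le.1 hge).eq_or_lt with heq | hlt
      · rw [heq]; exact h.refl (hmix p hp)
      · exact (h.mix_strict_mix (hδ b) (hδ w) hs (key q hq).1.1 hlt (key p hp).1.2).1

end IsVNM

namespace Represents

variable {Z : Type*} [Fintype Z] {R : (Z → ℝ) → (Z → ℝ) → Prop} {u u' : Z → ℝ}

lemma strictPref_iff (hu : Represents R u) {p q : Z → ℝ} (hp : IsLottery p)
    (hq : IsLottery q) : StrictPref R p q ↔ expUtil u q < expUtil u p := by
  rw [StrictPref, hu p q hp hq, hu q p hq hp, ge_iff_le, ge_iff_le, not_le]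
  exact ⟨fun h => h.2, fun h => ⟨h.le, h⟩⟩

lemma isVNM (hu : Represents R u) : IsVNM R where
  complete p q hp hq := by
    rw [hu p q hp hq, hu q p hq hp]
    exact le_total _ _
  transitive p q r hp hq hr := by
    rw [hu p q hp hq, hu q r hq hr, hu p r hp hr]
    exact fun h1 h2 => le_trans h2 h1
  independent p q r hp hq hr α h0 h1 := by
    rw [hu.strictPref_iff hp hq, hu.strictPref_iff (hp.mix hr h0.le h1) (hq.mix hr h0.le h1),
      expUtil_mix, expUtil_mix]
    intro h
    have := mul_lt_mul_of_pos_left h h0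
    linarith
  continuous p q r hp hq hr := by
    rw [hu.strictPref_iff hp hq, hu.strictPref_iff hq hr]
    intro h1 h2
    set a := expUtil u p
    set b := expUtil u q
    set c := expUtil u r
    have hac : 0 < a - c := by linarith
    set t := (b - c) / (a - c) with ht
    have hb : t * (a - c) = b - c := div_mul_cancel₀ _ hac.ne'
    have ht0 : 0 < t := div_pos (by linarith) hac
    have ht1 : t < 1 := (div_lt_one hac).2 (by linarith)
    refine ⟨(t + 1) / 2, t / 2, by linarith, by linarith, by linarith, by linarith, ?_, ?_⟩
    · rw [hu.strictPref_iff (hp.mix hr (by linarith) (by linarith)) hq, expUtil_mix]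
      change b < _ * a + _ * c
      nlinarith
    · rw [hu.strictPref_iff hq (hp.mix hr (by linarith) (by linarith)), expUtil_mix]
      change _ * a + _ * c < b
      nlinarith

lemma expUtil_eq (hu : Represents R u) (hu' : Represents R u') {p q : Z → ℝ}
    (hp : IsLottery p) (hq : IsLottery q) (h : expUtil u p = expUtil u q) :
    expUtil u' p = expUtil u' q :=
  le_antisymm ((hu' q p hq hp).1 ((hu q p hq hp).2 h.le))
    ((hu' p q hp hq).1 ((hu p q hp hq).2 h.ge))

/-- A von Neumann–Morgenstern utility is unique up to a positive affine transformation. -/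
theorem exists_affine [DecidableEq Z] [Nonempty Z] (hu : Represents R u)
    (hu' : Represents R u') : ∃ a b : ℝ, 0 < a ∧ ∀ z, u' z = a * u z + b := by
  obtain ⟨M, hM⟩ := Finite.exists_max u
  obtain ⟨m, hm⟩ := Finite.exists_min u
  have hδ : ∀ z : Z, IsLottery (Pi.single z (1 : ℝ)) := isLottery_single
  rcases (hm M).eq_or_lt with heq | hlt
  · refine ⟨1, u' m - u m, one_pos, fun z => ?_⟩
    have hz : u z = u m := le_antisymm (heq ▸ hM z) (hm z)
    have := hu.expUtil_eq hu' (hδ z) (hδ m) (by simpa only [expUtil_single] using hz)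
    rw [expUtil_single, expUtil_single] at this
    rw [this, hz]
    ring
  · have hd : 0 < u M - u m := sub_pos.2 hlt
    have hlt' : u' m < u' M := by
      have := (hu'.strictPref_iff (hδ M) (hδ m)).1
        ((hu.strictPref_iff (hδ M) (hδ m)).2 (by simpa only [expUtil_single] using hlt))
      simpa only [expUtil_single] using this
    refine ⟨(u' M - u' m) / (u M - u m), u' m - (u' M - u' m) / (u M - u m) * u m,
      div_pos (sub_pos.2 hlt') hd, fun z => ?_⟩
    have ht : (u z - u m) / (u M - u m) * (u M - u m) = u z - u m :=
      div_mul_cancel₀ _ hd.ne'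
    have := hu.expUtil_eq hu' (hδ z) ((hδ M).mix (hδ m)
      (div_nonneg (sub_nonneg.2 (hm z)) hd.le)
      ((div_le_one hd).2 (by linarith [hM z]))) (by
        rw [expUtil_mix, expUtil_single, expUtil_single, expUtil_single]
        linarith)
    rw [expUtil_mix, expUtil_single, expUtil_single, expUtil_single] at this
    rw [this]
    field_simp
    ring

end Represents

section PotentialOutcomes

variable {D Y X : Type*} [Fintype D] [DecidableEq D] [Fintype Y] [DecidableEq Y]
  [Fintype X] [DecidableEq X]

lemma IsLottery.eq_zero_of_sum_ite_eq_one {Z : Type*} [Fintype Z] {p : Z → ℝ}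
    (hp : IsLottery p) (P : Z → Prop) [DecidablePred P]
    (h : ∑ z, (if P z then p z else 0) = 1) {z : Z} (hz : ¬ P z) : p z = 0 := by
  have h0 : ∑ z, (p z - if P z then p z else 0) = 0 := by
    rw [Finset.sum_sub_distrib, hp.2, h, sub_self]
  rw [Finset.sum_eq_zero_iff_of_nonneg] at h0
  · simpa [hz] using h0 z (Finset.mem_univ z)
  · intro z _
    have := hp.1 z
    split_ifs <;> simp [this]

/-- With the decision and the covariate fixed, the expected additive utility depends only on
the marginals of the potential outcomes. -/
lemma expUtil_additive_eq (u : D → D × Y × X → ℝ) {p : D × (D → Y) × X → ℝ}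
    (hp : IsLottery p) {d : D} {x : X} (hd : probDec p d = 1) (hx : probCov p x = 1) :
    expUtil (fun z => ∑ k, u k (z.1, z.2.1 k, z.2.2)) p =
      ∑ k, ∑ v, u k (d, v, x) * probOut p k v := by
  simp only [expUtil, probOut, Finset.mul_sum, Finset.sum_mul]
  rw [Finset.sum_comm]
  refine Finset.sum_congr rfl fun k _ => ?_
  rw [Finset.sum_comm]
  refine Finset.sum_congr rfl fun z _ => ?_
  by_cases h1 : z.1 = d
  · by_cases h2 : z.2.2 = x
    · simp [h1, h2]
    · simp [hp.eq_zero_of_sum_ite_eq_one _ hx h2]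
  · simp [hp.eq_zero_of_sum_ite_eq_one _ hd h1]

lemma irrelevance_of_represents
    {R : (D × (D → Y) × X → ℝ) → (D × (D → Y) × X → ℝ) → Prop} (u : D → D × Y × X → ℝ)
    (hu : Represents R (fun z => ∑ k, u k (z.1, z.2.1 k, z.2.2))) :
    IrrelevanceCounterfactualCorrelation R := by
  intro p q hp hq d x hpd hqd hpx hqx hm
  have e : expUtil (fun z => ∑ k, u k (z.1, z.2.1 k, z.2.2)) p =
      expUtil (fun z => ∑ k, u k (z.1, z.2.1 k, z.2.2)) q := by
    simp only [expUtil_additive_eq u hp hpd hpx, expUtil_additive_eq u hq hqd hqx, hm]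
  exact ⟨(hu p q hp hq).2 e.ge, (hu q p hq hp).2 e.le⟩

/-- The uniform mixture of a family of degenerate lotteries. -/
noncomputable def uniformSingle {Z : Type*} [DecidableEq Z] (f : D → Z) : Z → ℝ :=
  fun z => ∑ j, (Fintype.card D : ℝ)⁻¹ * (Pi.single (f j) (1 : ℝ) : Z → ℝ) z

omit [DecidableEq D] in
lemma sum_mul_uniformSingle {Z : Type*} [Fintype Z] [DecidableEq Z] (f : D → Z) (g : Z → ℝ) :
    ∑ z, g z * uniformSingle f z = (Fintype.card D : ℝ)⁻¹ * ∑ j, g (f j) := by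
  simp only [uniformSingle, Finset.mul_sum]
  rw [Finset.sum_comm]
  refine Finset.sum_congr rfl fun j _ => ?_
  simp [Pi.single_apply, mul_comm]

omit [DecidableEq D] in
lemma sum_ite_uniformSingle {Z : Type*} [Fintype Z] [DecidableEq Z] (f : D → Z) (P : Z → Prop)
    [DecidablePred P] :
    ∑ z, (if P z then uniformSingle f z else 0) =
      (Fintype.card D : ℝ)⁻¹ * ∑ j, if P (f j) then 1 else 0 := by
  rw [← sum_mul_uniformSingle f fun z => if P z then 1 else 0]
  simp

omit [DecidableEq D] in
lemma isLottery_uniformSingle [Nonempty D] {Z : Type*} [Fintype Z] [DecidableEq Z] (f : D → Z) :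
    IsLottery (uniformSingle f) := by
  refine ⟨fun z => Finset.sum_nonneg fun j _ =>
    mul_nonneg (by positivity) ((isLottery_single (f j)).1 z), ?_⟩
  have := sum_mul_uniformSingle f fun _ => 1
  simpa using this

/-- Under irrelevance of counterfactual correlation, a von Neumann–Morgenstern utility is
determined by its values at outcome profiles differing from a base profile in one coordinate. -/
lemma sum_update_eq [Nonempty D]
    {R : (D × (D → Y) × X → ℝ) → (D × (D → Y) × X → ℝ) → Prop}
    (hR : IrrelevanceCounterfactualCorrelation R) {u : D × (D → Y) × X → ℝ}
    (hu : Represents R u) (d : D) (x : X) (y y₀ : D → Y) :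
    ∑ k, u (d, Function.update y₀ k (y k), x) =
      u (d, y, x) + ((Fintype.card D : ℝ) - 1) * u (d, y₀, x) := by
  obtain ⟨i⟩ := ‹Nonempty D›
  have : Nonempty D := ⟨i⟩
  have hn : (Fintype.card D : ℝ) ≠ 0 := by simp
  set f : D → D × (D → Y) × X := fun k => (d, Function.update y₀ k (y k), x) with hf
  set g : D → D × (D → Y) × X := fun k => (d, if k = i then y else y₀, x) with hg
  have hsum : ∀ (a b : ℝ) (k : D), ∑ j, (if j = k then a else b) =
      a + ((Fintype.card D : ℝ) - 1) * b := by
    intro a b k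
    rw [← Finset.add_sum_erase _ _ (Finset.mem_univ k), if_pos rfl,
      Finset.sum_congr rfl fun j hj => if_neg (Finset.ne_of_mem_erase hj)]
    simp [Finset.card_erase_of_mem, Nat.cast_sub Fintype.card_pos]
  have hpf := isLottery_uniformSingle f
  have hpg := isLottery_uniformSingle g
  have hfg := hR _ _ hpf hpg d x
    (by rw [probDec, sum_ite_uniformSingle]; simp [hf])
    (by rw [probDec, sum_ite_uniformSingle]; simp [hg])
    (by rw [probCov, sum_ite_uniformSingle]; simp [hf])
    (by rw [probCov, sum_ite_uniformSingle]; simp [hg])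
    (fun k v => by
      rw [probOut, probOut, sum_ite_uniformSingle _ fun z : D × (D → Y) × X => z.2.1 k = v,
        sum_ite_uniformSingle _ fun z : D × (D → Y) × X => z.2.1 k = v]
      congr 1
      trans (if y k = v then (1 : ℝ) else 0) +
        ((Fintype.card D : ℝ) - 1) * (if y₀ k = v then 1 else 0)
      · rw [← hsum _ _ k]
        refine Finset.sum_congr rfl fun j _ => ?_
        by_cases hj : j = k
        · subst hj; simp [hf]
        · simp [hf, hj, Function.update_of_ne (Ne.symm hj)]
      · rw [← hsum _ _ i]
        refine Finset.sum_congr rfl fun j _ => ?_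
        by_cases hj : j = i <;> simp [hg, hj])
  have e : expUtil u (uniformSingle f) = expUtil u (uniformSingle g) :=
    le_antisymm ((hu _ _ hpg hpf).1 hfg.2) ((hu _ _ hpf hpg).1 hfg.1)
  rw [expUtil, expUtil, sum_mul_uniformSingle, sum_mul_uniformSingle] at e
  rw [← hsum _ _ i]
  refine (mul_left_cancel₀ (inv_ne_zero hn) e).trans (Finset.sum_congr rfl fun j _ => ?_)
  by_cases hj : j = i <;> simp [hg, hj]

lemma exists_additive_represents [Nonempty D] [Nonempty Y]
    {R : (D × (D → Y) × X → ℝ) → (D × (D → Y) × X → ℝ) → Prop}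
    (hR : IrrelevanceCounterfactualCorrelation R) {u : D × (D → Y) × X → ℝ}
    (hu : Represents R u) :
    ∃ w : D → D × Y × X → ℝ, Represents R (fun z => ∑ k, w k (z.1, z.2.1 k, z.2.2)) := by
  obtain ⟨v₀⟩ := ‹Nonempty Y›
  have hn : (Fintype.card D : ℝ) ≠ 0 := by simp
  refine ⟨fun k t => u (t.1, Function.update (fun _ => v₀) k t.2.1, t.2.2) -
    ((Fintype.card D : ℝ) - 1) / Fintype.card D * u (t.1, fun _ => v₀, t.2.2), ?_⟩
  convert hu using 1
  ext ⟨d, y, x⟩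
  rw [Finset.sum_sub_distrib, sum_update_eq hR hu d x y]
  simp only [Finset.sum_const, Finset.card_univ, nsmul_eq_mul]
  field_simp
  ring

end PotentialOutcomes

/-- Preferences satisfying the vNM axioms together with Irrelevance of Counterfactual
Correlation are exactly those represented by an additive counterfactual utility
`ũ(d, y, x) = ∑ k, u_k(d, y k, x)`; moreover the representing utility `ũ` is unique up to
a positive affine transformation. -/
theorem additive_utility_representation
    (D Y X : Type*) [Fintype D] [DecidableEq D] [Nonempty D]
    [Fintype Y] [DecidableEq Y] [Nonempty Y]
    [Fintype X] [DecidableEq X] [Nonempty X]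
    (R : (D × (D → Y) × X → ℝ) → (D × (D → Y) × X → ℝ) → Prop) :
    ((CompleteAx R ∧ TransitiveAx R ∧ IndependenceAx R ∧ ContinuityAx R ∧
        IrrelevanceCounterfactualCorrelation R) ↔
      ∃ u : D → D × Y × X → ℝ,
        Represents R (fun z => ∑ k, u k (z.1, z.2.1 k, z.2.2))) ∧
    (∀ u u' : D → D × Y × X → ℝ,
      Represents R (fun z => ∑ k, u k (z.1, z.2.1 k, z.2.2)) →
      Represents R (fun z => ∑ k, u' k (z.1, z.2.1 k, z.2.2)) →
      ∃ a b : ℝ, 0 < a ∧ ∀ z : D × (D → Y) × X,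
        (∑ k, u' k (z.1, z.2.1 k, z.2.2)) = a * (∑ k, u k (z.1, z.2.1 k, z.2.2)) + b) := by
  refine ⟨⟨?_, ?_⟩, fun u u' hu hu' => hu.exists_affine hu'⟩
  · rintro ⟨h1, h2, h3, h4, h5⟩
    obtain ⟨u, hu⟩ := IsVNM.exists_represents ⟨h1, h2, h3, h4⟩
    exact exists_additive_represents h5 hu
  · rintro ⟨u, hu⟩
    have h := hu.isVNM
    exact ⟨h.complete, h.transitive, h.independent, h.continuous, irrelevance_of_represents u hu⟩
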